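/- arXiv:1406.1023 — 5 statements merged into one kernel-verified Lean document; each statement's English description precedes it below -/
import Mathlib

section
/- Under the stated invariance assumptions, the induced measure μ on X is relatively invariant with multiplier Δ^{-1}: for every g₀ ∈ G and every μ-integrable function f on X, ∫_X f(g₀x) dμ(x) = Δ(g₀) · ∫_X f(x) dμ(x); equivalently, the pushforward of μ under the map x ↦ g₀x equals Δ(g₀)^{-1}·μ. -/
open MeasureTheory
open scoped ENNReal

/-- If `ν` is invariant under a map `φ` and `Δ ∘ φ = c • Δ`, then integrals against `Δ⁻¹ dν` are
scaled by `c` under `φ`. When `φ` is not a.e. measurable, invariance forces `ν = 0`. -/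
theorem lintegral_withDensity_inv_comp_of_map_eq {G : Type*} [MeasurableSpace G] {ν : Measure G}
    {φ : G → G} (hφ : Measure.map φ ν = ν) {Δ : G → ℝ≥0∞} (hΔ : Measurable Δ) {c : ℝ≥0∞}
    (hc : c ≠ 0) (hc' : c ≠ ⊤) (hΔφ : ∀ g, Δ (φ g) = c * Δ g) {F : G → ℝ≥0∞}
    (hF : Measurable F) (hFφ : Measurable fun g => F (φ g)) :
    ∫⁻ g, F (φ g) ∂ν.withDensity (fun g => (Δ g)⁻¹)
      = c * ∫⁻ g, F g ∂ν.withDensity (fun g => (Δ g)⁻¹) := by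
  by_cases hφm : AEMeasurable φ ν
  · have hΔinv : Measurable fun g => (Δ g)⁻¹ := hΔ.inv
    rw [lintegral_withDensity_eq_lintegral_mul _ hΔinv hFφ,
      lintegral_withDensity_eq_lintegral_mul _ hΔinv hF]
    have key : ∫⁻ g, ((fun g => (Δ g)⁻¹) * F) g ∂ν
        = ∫⁻ g, ((fun g => (Δ g)⁻¹) * F) (φ g) ∂ν := by
      conv_lhs => rw [← hφ]
      exact lintegral_map' (hΔinv.mul hF).aemeasurable hφm
    rw [key, ← lintegral_const_mul' _ _ hc']
    refine lintegral_congr fun g => ?_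
    simp only [Pi.mul_apply]
    rw [hΔφ, ENNReal.mul_inv (Or.inl hc) (Or.inl hc'), mul_assoc, ← mul_assoc c,
      ENNReal.mul_inv_cancel hc hc', one_mul]
  · rw [Measure.map_of_not_aemeasurable hφm] at hφ
    simp [← hφ]

/-- A multiplicative function on a group with values in `(0, ∞)` commutes with inversion. -/
theorem ENNReal.map_inv_of_map_mul {G : Type*} [Group G] {Δ : G → ℝ≥0∞}
    (hpos : ∀ g, 0 < Δ g) (hfin : ∀ g, Δ g ≠ ⊤) (hmul : ∀ g₁ g₂ : G, Δ (g₁ * g₂) = Δ g₁ * Δ g₂)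
    (g : G) : Δ g⁻¹ = (Δ g)⁻¹ := by
  have h1 : Δ 1 = 1 := by
    have h := hmul 1 1
    rw [mul_one] at h
    exact (ENNReal.mul_eq_left (hpos 1).ne' (hfin 1)).1 h.symm
  refine ENNReal.eq_inv_of_mul_eq_one_left ?_
  rw [← hmul, inv_mul_cancel, h1]

/-- **Lemma (relative invariance of the induced measure on `X`).** Under the invariance
assumptions (left/right Haar measures `Hl`, `Hr` related by the modular function `Δ`, group
`G` acting on `X` with bi-measurable bijective orbit maps, `μ` the pushforward of `Hr` under
any orbit map), `μ` is relatively invariant with multiplier `Δ⁻¹`: for every `g₀ ∈ G` and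
every (measurable nonnegative) function `f` on `X`, `∫ f(g₀x) dμ(x) = Δ(g₀)·∫ f dμ`;
equivalently, the pushforward of `μ` under `x ↦ g₀x` scales `μ` by `Δ(g₀)⁻¹`, i.e. the image
`g₀·A` of any measurable set `A` has measure `μ(g₀·A) = Δ(g₀)⁻¹·μ(A)`. -/
theorem induced_measure_relatively_invariant
    {G X : Type*} [Group G] [MeasurableSpace G] [MeasurableSpace X] [MulAction G X]
    (Hl Hr : Measure G) (Δ : G → ℝ≥0∞)
    (hΔmeas : Measurable Δ) (hΔpos : ∀ g, 0 < Δ g) (hΔfin : ∀ g, Δ g ≠ ⊤)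
    (hΔmul : ∀ g₁ g₂ : G, Δ (g₁ * g₂) = Δ g₁ * Δ g₂)
    (hHlinv : ∀ g₀ : G, Measure.map (fun g => g₀ * g) Hl = Hl)
    (hHrdef : Hr = Hl.withDensity (fun g => (Δ g)⁻¹))
    (hHrinv : ∀ g₀ : G, Measure.map (fun g => g * g₀) Hr = Hr)
    (hactX : ∀ g : G, Measurable fun x : X => g • x)
    (horbX : ∀ x : X, Measurable fun g : G => g • x)
    (hbijX : ∀ x : X, Function.Bijective fun g : G => g • x)
    (μ : Measure X)
    (hμ : ∀ x : X, Measure.map (fun g : G => g • x) Hr = μ) :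
    ∀ g₀ : G,
      (∀ f : X → ℝ≥0∞, Measurable f →
        ∫⁻ x, f (g₀ • x) ∂μ = Δ g₀ * ∫⁻ x, f x ∂μ)
      ∧ ∀ A : Set X, MeasurableSet A →
          μ ((fun x : X => g₀ • x) '' A) = (Δ g₀)⁻¹ * μ A := by
  have hint : ∀ g₀ : G, ∀ f : X → ℝ≥0∞, Measurable f →
      ∫⁻ x, f (g₀ • x) ∂μ = Δ g₀ * ∫⁻ x, f x ∂μ := by
    intro g₀ f hf
    rcases isEmpty_or_nonempty X with hX | ⟨⟨x₀⟩⟩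
    · simp [Measure.eq_zero_of_isEmpty μ]
    have hf₀ : Measurable fun x : X => f (g₀ • x) := hf.comp (hactX g₀)
    rw [← hμ x₀, lintegral_map hf₀ (horbX x₀), lintegral_map hf (horbX x₀), hHrdef]
    simp only [← mul_smul]
    refine lintegral_withDensity_inv_comp_of_map_eq (F := fun g => f (g • x₀)) (hHlinv g₀)
      hΔmeas (hΔpos g₀).ne' (hΔfin g₀) (hΔmul g₀) (hf.comp (horbX x₀)) ?_
    simpa only [mul_smul, Function.comp_def] using hf₀.comp (horbX x₀)
  refine fun g₀ => ⟨hint g₀, fun A hA => ?_⟩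
  have himg : (fun x : X => g₀ • x) '' A = (fun x : X => g₀⁻¹ • x) ⁻¹' A :=
    (Set.preimage_smul_inv g₀ A).symm
  have h := hint g₀⁻¹ (A.indicator 1) (measurable_one.indicator hA)
  rw [lintegral_indicator_one hA, ENNReal.map_inv_of_map_mul hΔpos hΔfin hΔmul] at h
  rw [himg, ← h, ← lintegral_indicator_one (hactX g₀⁻¹ hA)]
  rfl
end

section
/- For every measurable set R ⊆ Θ₀ × Θ₁ and every ζ > 0, the following integrated Neyman–Pearson inequality holds: ζ·(PD_B(R,x) − PD_B(R*(x),x))/m₀(x) ≤ (PFA_B(R,x) − PFA_B(R*(x),x))/m₁(x), where R*(x) = {(θ₀,θ₁) ∈ Θ₀×Θ₁ : p(x|θ₀) < ζ·p(x|θ₁)}. -/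
open MeasureTheory
open scoped ENNReal

/-- The weighted error inequality of the Neyman–Pearson lemma: the set `{f < g}` minimises
`∫⁻ S, f - ∫⁻ S, g` over measurable sets `S`. -/
theorem setLIntegral_add_setLIntegral_lt_le {α : Type*} [MeasurableSpace α] (μ : Measure α)
    {f g : α → ℝ≥0∞} (hf : Measurable f) (hg : Measurable g) {s : Set α}
    (hs : MeasurableSet s) :
    (∫⁻ a in s, g a ∂μ) + ∫⁻ a in {a | f a < g a}, f a ∂μ
      ≤ (∫⁻ a in s, f a ∂μ) + ∫⁻ a in {a | f a < g a}, g a ∂μ := by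
  classical
  have ht : MeasurableSet {a | f a < g a} := measurableSet_lt hf hg
  rw [← lintegral_indicator hs, ← lintegral_indicator hs, ← lintegral_indicator ht,
    ← lintegral_indicator ht, ← lintegral_add_left (hg.indicator hs),
    ← lintegral_add_left (hf.indicator hs)]
  refine lintegral_mono fun a => ?_
  by_cases has : a ∈ s <;> by_cases hat : f a < g a
  · simp [has, hat, add_comm]
  · simpa [has, hat] using not_lt.1 hat
  · simpa [has, hat] using hat.le
  · simp [has, hat]

/-- A product whose left factor is a rescaled density, evaluated on a measurable set. -/
theorem smul_withDensity_prod_apply {α β : Type*} [MeasurableSpace α] [MeasurableSpace β]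
    (μ : Measure α) (ν : Measure β) [SFinite μ] [SFinite ν] {f : α → ℝ≥0∞}
    (hf : Measurable f) (c : ℝ≥0∞) {s : Set (α × β)} (hs : MeasurableSet s) :
    ((c • μ.withDensity f).prod ν) s = c * ∫⁻ q in s, f q.1 ∂μ.prod ν := by
  rw [Measure.prod_smul_left, prod_withDensity_left hf, Measure.smul_apply,
    withDensity_apply _ hs, smul_eq_mul]

/-- A product whose right factor is a rescaled density, evaluated on a measurable set. -/
theorem prod_smul_withDensity_apply {α β : Type*} [MeasurableSpace α] [MeasurableSpace β]
    (μ : Measure α) (ν : Measure β) [SFinite μ] [SFinite ν] {f : β → ℝ≥0∞}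
    (hf : Measurable f) (c : ℝ≥0∞) {s : Set (α × β)} (hs : MeasurableSet s) :
    (μ.prod (c • ν.withDensity f)) s = c * ∫⁻ q in s, f q.2 ∂μ.prod ν := by
  rw [Measure.prod_smul_right, prod_withDensity_right hf, Measure.smul_apply,
    withDensity_apply _ hs, smul_eq_mul]

/-- **Integrated Neyman–Pearson inequality (Bayesian type).** With proper priors `prior0`,
`prior1`, likelihoods `p0`, `p1` at the observed data `x`, marginals `m0`, `m1`, posteriors
`post0 = m0⁻¹·p0·prior0`, `post1 = m1⁻¹·p1·prior1`, and the Bayesian-type error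
probabilities `PFA_B(R) = (post0 ⊗ prior1)(R)` and `PD_B(R) = (prior0 ⊗ post1)(R)`, every
measurable `R ⊆ Θ₀ × Θ₁` and every `ζ > 0` satisfy
`ζ·(PD_B(R) − PD_B(R*))/m0 ≤ (PFA_B(R) − PFA_B(R*))/m1` where
`R* = {(θ₀,θ₁) : p0(θ₀) < ζ·p1(θ₁)}` is the likelihood-ratio rejection set. -/
theorem bayesian_neyman_pearson_inequality
    {Θ₀ Θ₁ : Type*} [MeasurableSpace Θ₀] [MeasurableSpace Θ₁]
    (prior0 : Measure Θ₀) [IsProbabilityMeasure prior0]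
    (prior1 : Measure Θ₁) [IsProbabilityMeasure prior1]
    (p0 : Θ₀ → ℝ≥0∞) (p1 : Θ₁ → ℝ≥0∞) (hp0 : Measurable p0) (hp1 : Measurable p1)
    (m0 m1 : ℝ≥0∞)
    (hm0 : m0 = ∫⁻ θ₀, p0 θ₀ ∂prior0) (hm1 : m1 = ∫⁻ θ₁, p1 θ₁ ∂prior1)
    (hm0pos : m0 ≠ 0) (hm0fin : m0 ≠ ⊤) (hm1pos : m1 ≠ 0) (hm1fin : m1 ≠ ⊤)
    (post0 : Measure Θ₀) [IsProbabilityMeasure post0]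
    (hpost0 : post0 = m0⁻¹ • prior0.withDensity p0)
    (post1 : Measure Θ₁) [IsProbabilityMeasure post1]
    (hpost1 : post1 = m1⁻¹ • prior1.withDensity p1)
    (ζ : ℝ≥0∞) (hζpos : 0 < ζ) (hζfin : ζ ≠ ⊤) :
    ∀ R : Set (Θ₀ × Θ₁), MeasurableSet R →
      ζ.toReal *
          ((((prior0.prod post1) R).toReal
              - (((prior0.prod post1) {q : Θ₀ × Θ₁ | p0 q.1 < ζ * p1 q.2}).toReal))
            / m0.toReal)
        ≤ (((post0.prod prior1) R).toReal
              - (((post0.prod prior1) {q : Θ₀ × Θ₁ | p0 q.1 < ζ * p1 q.2}).toReal))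
            / m1.toReal := by
  intro R hR
  set T : Set (Θ₀ × Θ₁) := {q | p0 q.1 < ζ * p1 q.2} with hT
  have hf : Measurable fun q : Θ₀ × Θ₁ => p0 q.1 := hp0.comp measurable_fst
  have hg : Measurable fun q : Θ₀ × Θ₁ => p1 q.2 := hp1.comp measurable_snd
  have hTm : MeasurableSet T := measurableSet_lt hf (hg.const_mul ζ)
  have fin0 (S : Set (Θ₀ × Θ₁)) : ∫⁻ q in S, p0 q.1 ∂prior0.prod prior1 ≠ ∞ := by
    refine ne_top_of_le_ne_top ?_ (setLIntegral_le_lintegral S _)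
    rw [lintegral_prod _ hf.aemeasurable]
    simpa [← hm0] using hm0fin
  have fin1 (S : Set (Θ₀ × Θ₁)) : ∫⁻ q in S, p1 q.2 ∂prior0.prod prior1 ≠ ∞ := by
    refine ne_top_of_le_ne_top ?_ (setLIntegral_le_lintegral S _)
    rw [lintegral_prod _ hg.aemeasurable]
    simpa [← hm1] using hm1fin
  have key := setLIntegral_add_setLIntegral_lt_le (prior0.prod prior1) hf (hg.const_mul ζ) hR
  rw [← hT, lintegral_const_mul _ hg, lintegral_const_mul _ hg] at key
  have key' := ENNReal.toReal_mono
    (ENNReal.add_ne_top.2 ⟨fin0 R, ENNReal.mul_ne_top hζfin (fin1 T)⟩) key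
  rw [ENNReal.toReal_add (ENNReal.mul_ne_top hζfin (fin1 R)) (fin0 T),
    ENNReal.toReal_add (fin0 R) (ENNReal.mul_ne_top hζfin (fin1 T)),
    ENNReal.toReal_mul, ENNReal.toReal_mul] at key'
  have h0 := ENNReal.toReal_pos hm0pos hm0fin
  have h1 := ENNReal.toReal_pos hm1pos hm1fin
  rw [hpost0, hpost1, prod_smul_withDensity_apply _ _ hp1 _ hR,
    prod_smul_withDensity_apply _ _ hp1 _ hTm, smul_withDensity_prod_apply _ _ hp0 _ hR,
    smul_withDensity_prod_apply _ _ hp0 _ hTm]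
  simp only [ENNReal.toReal_mul, ENNReal.toReal_inv]
  generalize (∫⁻ q in R, p0 q.1 ∂prior0.prod prior1).toReal = a at *
  generalize (∫⁻ q in T, p0 q.1 ∂prior0.prod prior1).toReal = b at *
  generalize (∫⁻ q in R, p1 q.2 ∂prior0.prod prior1).toReal = c at *
  generalize (∫⁻ q in T, p1 q.2 ∂prior0.prod prior1).toReal = d at *
  calc ζ.toReal * ((m1.toReal⁻¹ * c - m1.toReal⁻¹ * d) / m0.toReal)
      = (ζ.toReal * c - ζ.toReal * d) * (m0.toReal⁻¹ * m1.toReal⁻¹) := by ring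
    _ ≤ (a - b) * (m0.toReal⁻¹ * m1.toReal⁻¹) := by gcongr ?_ * _; linarith
    _ = (m0.toReal⁻¹ * a - m0.toReal⁻¹ * b) / m1.toReal := by ring
end

section
/- Bayesian-type Neyman–Pearson lemma, first direction: among all measurable sets R ⊆ Θ₀ × Θ₁, the likelihood-ratio rejection set R*(x) = {(θ₀,θ₁) : p(x|θ₀) < ζ·p(x|θ₁)} maximizes PD_B for fixed PFA_B: for every measurable R with PFA_B(R,x) ≤ PFA_B(R*(x),x), one has PD_B(R,x) ≤ PD_B(R*(x),x). Moreover PD_B(R*(x),x) = PLR₁(x,ζ), the Posterior distribution of the Likelihood Ratio under H₁. -/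
open MeasureTheory
open scoped ENNReal

/-- Among measurable sets whose `f`-mass does not exceed that of `{f < g}`, the set `{f < g}`
has maximal `g`-mass. -/
theorem setLIntegral_le_setLIntegral_lt_of_le {α : Type*} [MeasurableSpace α] {μ : Measure α}
    {f g : α → ℝ≥0∞} (hf : Measurable f) (hg : Measurable g) (hfin : ∫⁻ a, f a ∂μ ≠ ⊤)
    {R : Set α} (hR : MeasurableSet R)
    (h : ∫⁻ a in R, f a ∂μ ≤ ∫⁻ a in {a | f a < g a}, f a ∂μ) :
    ∫⁻ a in R, g a ∂μ ≤ ∫⁻ a in {a | f a < g a}, g a ∂μ := by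
  have hS : MeasurableSet {a | f a < g a} := measurableSet_lt hf hg
  generalize hSdef : {a | f a < g a} = S at *
  rw [← lintegral_inter_add_sdiff f R hS, ← lintegral_inter_add_sdiff f S hR,
    Set.inter_comm S R] at h
  have hRS : ∫⁻ a in R ∩ S, f a ∂μ ≠ ⊤ := ne_top_of_le_ne_top hfin (setLIntegral_le_lintegral _ _)
  rw [← lintegral_inter_add_sdiff g R hS, ← lintegral_inter_add_sdiff g S hR,
    Set.inter_comm S R]
  refine add_le_add le_rfl ?_
  calc ∫⁻ a in R \ S, g a ∂μ ≤ ∫⁻ a in R \ S, f a ∂μ :=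
        setLIntegral_mono' (hR.diff hS) fun a ha => not_lt.1 (by simpa [← hSdef] using ha.2)
    _ ≤ ∫⁻ a in S \ R, f a ∂μ := (ENNReal.add_le_add_iff_left hRS).1 h
    _ ≤ ∫⁻ a in S \ R, g a ∂μ :=
        setLIntegral_mono' (hS.diff hR) fun a ha => le_of_lt (by simpa [← hSdef] using ha.1)

/-- **Bayesian-type Neyman–Pearson lemma, first direction.** With proper priors `prior0`,
`prior1`, likelihoods `p0`, `p1` at the observed data `x`, posteriors
`post0 = m0⁻¹·p0·prior0`, `post1 = m1⁻¹·p1·prior1`, Bayesian-type error probabilities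
`PFA_B(R) = (post0 ⊗ prior1)(R)` and `PD_B(R) = (prior0 ⊗ post1)(R)`, the likelihood-ratio
rejection set `R* = {(θ₀,θ₁) : p0(θ₀) < ζ·p1(θ₁)}` maximizes `PD_B` for fixed `PFA_B`:
any measurable `R` with `PFA_B(R) ≤ PFA_B(R*)` has `PD_B(R) ≤ PD_B(R*)`.  Moreover
`PD_B(R*) = PLR₁(x,ζ)`, the Posterior distribution of the Likelihood Ratio under `H₁`. -/
theorem bayesian_neyman_pearson_first_direction
    {Θ₀ Θ₁ : Type*} [MeasurableSpace Θ₀] [MeasurableSpace Θ₁]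
    (prior0 : Measure Θ₀) [IsProbabilityMeasure prior0]
    (prior1 : Measure Θ₁) [IsProbabilityMeasure prior1]
    (p0 : Θ₀ → ℝ≥0∞) (p1 : Θ₁ → ℝ≥0∞) (hp0 : Measurable p0) (hp1 : Measurable p1)
    (m0 m1 : ℝ≥0∞)
    (hm0 : m0 = ∫⁻ θ₀, p0 θ₀ ∂prior0) (hm1 : m1 = ∫⁻ θ₁, p1 θ₁ ∂prior1)
    (hm0pos : m0 ≠ 0) (hm0fin : m0 ≠ ⊤) (hm1pos : m1 ≠ 0) (hm1fin : m1 ≠ ⊤)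
    (post0 : Measure Θ₀) [IsProbabilityMeasure post0]
    (hpost0 : post0 = m0⁻¹ • prior0.withDensity p0)
    (post1 : Measure Θ₁) [IsProbabilityMeasure post1]
    (hpost1 : post1 = m1⁻¹ • prior1.withDensity p1)
    (ζ : ℝ≥0∞) (hζpos : 0 < ζ) (hζfin : ζ ≠ ⊤)
    (PLR1 : ℝ≥0∞)
    (hPLR1 : PLR1 = (prior0.prod post1) {q : Θ₀ × Θ₁ | p0 q.1 < ζ * p1 q.2}) :
    (∀ R : Set (Θ₀ × Θ₁), MeasurableSet R →
        (post0.prod prior1) R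
            ≤ (post0.prod prior1) {q : Θ₀ × Θ₁ | p0 q.1 < ζ * p1 q.2} →
        (prior0.prod post1) R
            ≤ (prior0.prod post1) {q : Θ₀ × Θ₁ | p0 q.1 < ζ * p1 q.2})
    ∧ (prior0.prod post1) {q : Θ₀ × Θ₁ | p0 q.1 < ζ * p1 q.2} = PLR1 := by
  refine ⟨fun R hR h => ?_, hPLR1.symm⟩
  have hf : Measurable fun q : Θ₀ × Θ₁ => p0 q.1 := hp0.comp measurable_fst
  have hg : Measurable fun q : Θ₀ × Θ₁ => p1 q.2 := hp1.comp measurable_snd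
  have hS : MeasurableSet {q : Θ₀ × Θ₁ | p0 q.1 < ζ * p1 q.2} :=
    measurableSet_lt hf (hg.const_mul ζ)
  have hfin : ∫⁻ q, p0 q.1 ∂(prior0.prod prior1) ≠ ⊤ := by
    simpa [lintegral_prod _ hf.aemeasurable, ← hm0] using hm0fin
  have hpfa (A : Set (Θ₀ × Θ₁)) (hA : MeasurableSet A) :
      (post0.prod prior1) A = m0⁻¹ * ∫⁻ q in A, p0 q.1 ∂(prior0.prod prior1) := by
    rw [hpost0, Measure.prod_smul_left, prod_withDensity_left hp0, Measure.smul_apply,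
      withDensity_apply _ hA, smul_eq_mul]
  have hpd (A : Set (Θ₀ × Θ₁)) (hA : MeasurableSet A) :
      (prior0.prod post1) A = m1⁻¹ * ∫⁻ q in A, p1 q.2 ∂(prior0.prod prior1) := by
    rw [hpost1, Measure.prod_smul_right, prod_withDensity_right hp1, Measure.smul_apply,
      withDensity_apply _ hA, smul_eq_mul]
  rw [hpfa R hR, hpfa _ hS, ENNReal.mul_le_mul_iff_right (ENNReal.inv_ne_zero.2 hm0fin)
    (ENNReal.inv_ne_top.2 hm0pos)] at h
  have key := setLIntegral_le_setLIntegral_lt_of_le hf (hg.const_mul ζ) hfin hR h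
  rw [lintegral_const_mul _ hg, lintegral_const_mul _ hg,
    ENNReal.mul_le_mul_iff_right hζpos.ne' hζfin] at key
  rw [hpd R hR, hpd _ hS]
  gcongr
end

section
/- Bayesian-type Neyman–Pearson lemma, reciprocal direction: among all measurable sets R ⊆ Θ₀ × Θ₁, the complement R̄*(x) of the likelihood-ratio rejection set R*(x) = {(θ₀,θ₁) : p(x|θ₀) < ζ·p(x|θ₁)} maximizes PFA_B for fixed PD_B: for every measurable R with PD_B(R,x) ≤ PD_B(R̄*(x),x), one has PFA_B(R,x) ≤ PFA_B(R̄*(x),x). -/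
open MeasureTheory
open scoped ENNReal

namespace MeasureTheory

theorem setLIntegral_le_of_setLIntegral_le_compl_setOf_lt {α : Type*} [MeasurableSpace α]
    {μ : Measure α} {f g : α → ℝ≥0∞} (hf : Measurable f) (hg : Measurable g)
    (hgfin : ∫⁻ a, g a ∂μ ≠ ⊤) {ζ : ℝ≥0∞} {R : Set α} (hR : MeasurableSet R)
    (h : ∫⁻ a in R, g a ∂μ ≤ ∫⁻ a in {a | f a < ζ * g a}ᶜ, g a ∂μ) :
    ∫⁻ a in R, f a ∂μ ≤ ∫⁻ a in {a | f a < ζ * g a}ᶜ, f a ∂μ := by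
  set A : Set α := {a | f a < ζ * g a}ᶜ
  have hAm : MeasurableSet A := (measurableSet_lt hf (hg.const_mul ζ)).compl
  rw [← lintegral_inter_add_sdiff g R hAm, ← lintegral_inter_add_sdiff g A hR,
    Set.inter_comm A R] at h
  have hfin : ∫⁻ a in R ∩ A, g a ∂μ ≠ ⊤ :=
    ne_top_of_le_ne_top hgfin (setLIntegral_le_lintegral _ _)
  have hdiff : ∫⁻ a in R \ A, g a ∂μ ≤ ∫⁻ a in A \ R, g a ∂μ :=
    (ENNReal.add_le_add_iff_left hfin).1 h
  rw [← lintegral_inter_add_sdiff f R hAm, ← lintegral_inter_add_sdiff f A hR, Set.inter_comm A R]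
  refine add_le_add_right ?_ _
  calc ∫⁻ a in R \ A, f a ∂μ
      ≤ ∫⁻ a in R \ A, ζ * g a ∂μ :=
        setLIntegral_mono (hg.const_mul ζ) fun a ha => (not_not.1 ha.2 : f a < ζ * g a).le
    _ = ζ * ∫⁻ a in R \ A, g a ∂μ := lintegral_const_mul ζ hg
    _ ≤ ζ * ∫⁻ a in A \ R, g a ∂μ := by gcongr
    _ = ∫⁻ a in A \ R, ζ * g a ∂μ := (lintegral_const_mul ζ hg).symm
    _ ≤ ∫⁻ a in A \ R, f a ∂μ := setLIntegral_mono hf fun a ha => not_lt.1 ha.1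

end MeasureTheory

/-- **Bayesian-type Neyman–Pearson lemma, reciprocal direction.** With proper priors
`prior0`, `prior1`, likelihoods `p0`, `p1` at the observed data `x`, posteriors
`post0 = m0⁻¹·p0·prior0`, `post1 = m1⁻¹·p1·prior1`, Bayesian-type error probabilities
`PFA_B(R) = (post0 ⊗ prior1)(R)` and `PD_B(R) = (prior0 ⊗ post1)(R)`, the complement
`R̄*` of the likelihood-ratio rejection set `R* = {(θ₀,θ₁) : p0(θ₀) < ζ·p1(θ₁)}`
maximizes `PFA_B` for fixed `PD_B`: any measurable `R` with `PD_B(R) ≤ PD_B(R̄*)` has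
`PFA_B(R) ≤ PFA_B(R̄*)`. -/
theorem bayesian_neyman_pearson_reciprocal_direction
    {Θ₀ Θ₁ : Type*} [MeasurableSpace Θ₀] [MeasurableSpace Θ₁]
    (prior0 : Measure Θ₀) [IsProbabilityMeasure prior0]
    (prior1 : Measure Θ₁) [IsProbabilityMeasure prior1]
    (p0 : Θ₀ → ℝ≥0∞) (p1 : Θ₁ → ℝ≥0∞) (hp0 : Measurable p0) (hp1 : Measurable p1)
    (m0 m1 : ℝ≥0∞)
    (hm0 : m0 = ∫⁻ θ₀, p0 θ₀ ∂prior0) (hm1 : m1 = ∫⁻ θ₁, p1 θ₁ ∂prior1)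
    (hm0pos : m0 ≠ 0) (hm0fin : m0 ≠ ⊤) (hm1pos : m1 ≠ 0) (hm1fin : m1 ≠ ⊤)
    (post0 : Measure Θ₀) [IsProbabilityMeasure post0]
    (hpost0 : post0 = m0⁻¹ • prior0.withDensity p0)
    (post1 : Measure Θ₁) [IsProbabilityMeasure post1]
    (hpost1 : post1 = m1⁻¹ • prior1.withDensity p1)
    (ζ : ℝ≥0∞) (hζpos : 0 < ζ) (hζfin : ζ ≠ ⊤) :
    ∀ R : Set (Θ₀ × Θ₁), MeasurableSet R →
      (prior0.prod post1) R
          ≤ (prior0.prod post1) ({q : Θ₀ × Θ₁ | p0 q.1 < ζ * p1 q.2}ᶜ) →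
      (post0.prod prior1) R
          ≤ (post0.prod prior1) ({q : Θ₀ × Θ₁ | p0 q.1 < ζ * p1 q.2}ᶜ) := by
  intro R hR h
  have hA : MeasurableSet ({q : Θ₀ × Θ₁ | p0 q.1 < ζ * p1 q.2}ᶜ) :=
    (measurableSet_lt (hp0.comp measurable_fst)
      ((hp1.comp measurable_snd).const_mul ζ)).compl
  rw [hpost1, Measure.prod_smul_right, prod_withDensity_right hp1, Measure.smul_apply,
    Measure.smul_apply, withDensity_apply _ hR, withDensity_apply _ hA, smul_eq_mul, smul_eq_mul,
    ENNReal.mul_le_mul_iff_right (ENNReal.inv_ne_zero.2 hm1fin) (ENNReal.inv_ne_top.2 hm1pos)] at h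
  rw [hpost0, Measure.prod_smul_left, prod_withDensity_left hp0, Measure.smul_apply,
    Measure.smul_apply, withDensity_apply _ hR, withDensity_apply _ hA]
  gcongr m0⁻¹ • ?_
  refine setLIntegral_le_of_setLIntegral_le_compl_setOf_lt (hp0.comp measurable_fst)
    (hp1.comp measurable_snd) ?_ hR h
  have hsnd : ∫⁻ q, p1 q.2 ∂prior0.prod prior1 = m1 := by
    rw [← lintegral_map hp1 measurable_snd, Measure.map_snd_prod, measure_univ, one_smul, hm1]
  exact hsnd.trans_ne hm1fin
end

section
/- Dempster's Gaussian reconciliation: let X₁,…,Xₙ be i.i.d. N(θ, σ²) with σ > 0 known, let x₀ be the observed sample with mean x̄₀, and place the improper uniform (Lebesgue) prior on θ ∈ ℝ, so the posterior of θ given x₀ is N(x̄₀, σ²/n). Then for the test of H₀ : θ = θ₀, the Posterior distribution of the Likelihood Ratio at threshold ζ = 1 satisfies PLR(x₀,1) = Pr( |θ − x̄₀| ≤ |x̄₀ − θ₀| | x₀ ) = 2Φ(√n·|x̄₀ − θ₀|/σ) − 1 = Pr( |X̄ − θ₀| < |x̄₀ − θ₀| | θ = θ₀ ), where Φ is the standard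 normal cumulative distribution function; that is, the PLR with ζ = 1 equals the frequentist probability, under θ₀, that the sample-mean statistic is strictly less extreme than the observed one. -/
open MeasureTheory ProbabilityTheory
open scoped ENNReal NNReal

/-- The probability of a centred closed interval under a symmetric atomless law. -/
lemma measure_abs_le_eq_cdf (μ : Measure ℝ) [IsProbabilityMeasure μ] [NullSingletonClass μ]
    (hμ : μ.map (fun x => -x) = μ) {a : ℝ} (ha : 0 ≤ a) :
    μ {x | |x| ≤ a} = ENNReal.ofReal (2 * cdf μ a - 1) := by
  have hsymm : μ.real (Set.Iio (-a)) = μ.real (Set.Ioi a) := by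
    conv_rhs => rw [← hμ, map_measureReal_apply measurable_neg measurableSet_Ioi]
    congr 1
    ext x
    simp
  have hcompl : μ.real (Set.Ioi a) = 1 - μ.real (Set.Iic a) := by
    rw [← Set.compl_Iic, probReal_compl_eq_one_sub measurableSet_Iic]
  have hdisj : Disjoint (Set.Iio (-a)) (Set.Icc (-a) a) :=
    Set.disjoint_left.2 fun x hx hx' => absurd hx'.1 (not_le.2 hx)
  have hunion := measureReal_union (μ := μ) hdisj measurableSet_Icc
  rw [Set.Iio_union_Icc_eq_Iic (by linarith)] at hunion
  have hset : {x : ℝ | |x| ≤ a} = Set.Icc (-a) a := by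
    ext x
    simp [abs_le]
  rw [hset, cdf_eq_real, ← ofReal_measureReal]
  congr 1
  linarith

lemma gaussianReal_eq_map_standard (m : ℝ) (v : ℝ≥0) :
    gaussianReal m v = (gaussianReal 0 1).map (fun x => m + √v * x) := by
  rw [← Function.comp_def (fun x => m + x) (fun x => √v * x),
    ← Measure.map_map (by fun_prop) (by fun_prop), gaussianReal_map_const_mul,
    gaussianReal_map_const_add]
  congr 1
  · simp
  · ext
    simp

lemma gaussianReal_abs_sub_le {m : ℝ} {v : ℝ≥0} (hv : v ≠ 0) {r : ℝ} (hr : 0 ≤ r) :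
    gaussianReal m v {x | |x - m| ≤ r}
      = ENNReal.ofReal (2 * cdf (gaussianReal 0 1) (r / √v) - 1) := by
  have := nullSingletonClass_gaussianReal (μ := 0) (one_ne_zero (α := ℝ≥0))
  have hpos : 0 < √(v : ℝ) := Real.sqrt_pos.2 (by positivity)
  rw [← measure_abs_le_eq_cdf _ (by simp [gaussianReal_map_neg]) (by positivity),
    gaussianReal_eq_map_standard m v,
    Measure.map_apply (by fun_prop) (measurableSet_le (by fun_prop) (by fun_prop))]
  congr 1
  ext x
  simp [abs_mul, abs_of_pos hpos, le_div_iff₀ hpos, mul_comm]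

lemma gaussianReal_abs_sub_lt {m : ℝ} {v : ℝ≥0} (hv : v ≠ 0) (r : ℝ) :
    gaussianReal m v {x | |x - m| < r} = gaussianReal m v {x | |x - m| ≤ r} := by
  have := nullSingletonClass_gaussianReal (μ := m) hv
  have hlt : {x : ℝ | |x - m| < r} = Set.Ioo (m - r) (m + r) := by
    ext x
    simp only [Set.mem_ofPred_eq, abs_lt, Set.mem_Ioo]
    constructor <;> rintro ⟨h, h'⟩ <;> constructor <;> linarith
  have hle : {x : ℝ | |x - m| ≤ r} = Set.Icc (m - r) (m + r) := by
    ext x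
    simp only [Set.mem_ofPred_eq, abs_le, Set.mem_Icc]
    constructor <;> rintro ⟨h, h'⟩ <;> constructor <;> linarith
  rw [hlt, hle]
  exact measure_congr Ioo_ae_eq_Icc

lemma map_sum_pi_gaussianReal {ι : Type*} [Fintype ι] (m : ℝ) (v : ℝ≥0) :
    (Measure.pi fun _ : ι => gaussianReal m v).map (fun y => ∑ i, y i)
      = gaussianReal (Fintype.card ι * m) (Fintype.card ι * v) := by
  have := Measure.isProbabilityMeasure_map (μ := Measure.pi fun _ : ι => gaussianReal m v)
    (f := fun y => ∑ i, y i) (by fun_prop)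
  refine Measure.ext_of_charFun ?_
  rw [charFun_map_sum_pi_eq_prod]
  ext t
  simp only [Finset.prod_const, Finset.card_univ, Pi.pow_apply, charFun_gaussianReal,
    ← Complex.exp_nat_mul]
  congr 1
  push_cast
  ring

lemma map_mean_pi_gaussianReal {ι : Type*} [Fintype ι] [Nonempty ι] (m : ℝ) (v : ℝ≥0) :
    (Measure.pi fun _ : ι => gaussianReal m v).map
        (fun y : ι → ℝ => (∑ i, y i) / Fintype.card ι)
      = gaussianReal m (v / Fintype.card ι) := by
  have hcard : (Fintype.card ι : ℝ) ≠ 0 := by simp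
  rw [← Function.comp_def (fun x : ℝ => x / Fintype.card ι) (fun y : ι → ℝ => ∑ i, y i),
    ← Measure.map_map (by fun_prop) (by fun_prop), map_sum_pi_gaussianReal,
    gaussianReal_map_div_const]
  congr 1
  · field_simp
  · ext
    simp only [NNReal.coe_div, NNReal.coe_mul, NNReal.coe_natCast, NNReal.coe_mk]
    field_simp

lemma prod_gaussianPDFReal_le_iff {ι : Type*} [Fintype ι] {v : ℝ≥0} (hv : v ≠ 0)
    (x : ι → ℝ) (a b : ℝ) :
    ∏ i, gaussianPDFReal a v (x i) ≤ ∏ i, gaussianPDFReal b v (x i)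
      ↔ ∑ i, (x i - b) ^ 2 ≤ ∑ i, (x i - a) ^ 2 := by
  have hpos : 0 < (v : ℝ) := by positivity
  simp only [gaussianPDFReal, Finset.prod_mul_distrib, ← Real.exp_sum, ← Finset.sum_div,
    Finset.sum_neg_distrib]
  rw [mul_le_mul_iff_right₀ (by positivity), Real.exp_le_exp,
    div_le_div_iff_of_pos_right (by positivity), neg_le_neg_iff]

lemma sum_sub_sq_le_iff_abs_sub_mean_le {ι : Type*} [Fintype ι] [Nonempty ι]
    (x : ι → ℝ) (a b : ℝ) :
    ∑ i, (x i - b) ^ 2 ≤ ∑ i, (x i - a) ^ 2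
      ↔ |b - (∑ i, x i) / Fintype.card ι| ≤ |(∑ i, x i) / Fintype.card ι - a| := by
  have hcard : 0 < (Fintype.card ι : ℝ) := by exact_mod_cast Fintype.card_pos
  have hsum (c : ℝ) : ∑ i, (x i - c) ^ 2
      = ∑ i, x i ^ 2 - 2 * c * ∑ i, x i + Fintype.card ι * c ^ 2 := by
    simp only [sub_sq, Finset.sum_add_distrib, Finset.sum_sub_distrib, Finset.sum_const,
      Finset.card_univ, nsmul_eq_mul, Finset.mul_sum]
    congr 2
    exact Finset.sum_congr rfl fun i _ => by ring
  set s := (∑ i, x i) / Fintype.card ι with hs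
  have hx : ∑ i, x i = Fintype.card ι * s := by rw [hs]; field_simp
  rw [← sq_le_sq, hsum, hsum, hx, ← mul_le_mul_iff_right₀ hcard (b := (b - s) ^ 2)]
  constructor <;> intro h <;> linarith

/-- **Dempster's Gaussian reconciliation.** Let `x₀ = (x₀ 1, …, x₀ n)` be an observed sample
of `n` i.i.d. `N(θ, σ²)` observations (`σ > 0` known) with sample mean `x̄₀`, with likelihood
`L θ = ∏ i, gaussianPDFReal θ σ² (x₀ i)`, and place the improper uniform prior on `θ`, so the
posterior of `θ` given `x₀` is `N(x̄₀, σ²/n)`.  Then for the test of `H₀ : θ = θ₀`, the PLR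
at threshold `ζ = 1` satisfies
`PLR(x₀,1) = Pr(|θ − x̄₀| ≤ |x̄₀ − θ₀| | x₀) = 2Φ(√n·|x̄₀ − θ₀|/σ) − 1
 = Pr(|X̄ − θ₀| < |x̄₀ − θ₀| | θ = θ₀)`,
where `Φ` is the standard normal CDF and `X̄` is the sample mean of a fresh sample of `n`
i.i.d. `N(θ₀,σ²)` observations. -/
theorem dempster_gaussian_reconciliation
    (n : ℕ) (hn : 0 < n) (σ : ℝ) (hσ : 0 < σ)
    (v vn : ℝ≥0) (hv : (v : ℝ) = σ ^ 2) (hvn : (vn : ℝ) = σ ^ 2 / n)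
    (x₀ : Fin n → ℝ) (xbar θ₀ : ℝ) (hxbar : xbar = (∑ i, x₀ i) / n)
    (L : ℝ → ℝ) (hL : L = fun θ => ∏ i, gaussianPDFReal θ v (x₀ i)) :
    gaussianReal xbar vn {θ : ℝ | L θ₀ ≤ L θ}
        = gaussianReal xbar vn {θ : ℝ | |θ - xbar| ≤ |xbar - θ₀|}
    ∧ gaussianReal xbar vn {θ : ℝ | |θ - xbar| ≤ |xbar - θ₀|}
        = ENNReal.ofReal
            (2 * cdf (gaussianReal 0 1) (Real.sqrt n * |xbar - θ₀| / σ) - 1)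
    ∧ (Measure.map (fun y : Fin n → ℝ => (∑ i, y i) / n)
          (Measure.pi fun _ : Fin n => gaussianReal θ₀ v))
          {mean : ℝ | |mean - θ₀| < |xbar - θ₀|}
        = ENNReal.ofReal
            (2 * cdf (gaussianReal 0 1) (Real.sqrt n * |xbar - θ₀| / σ) - 1) := by
  have : Nonempty (Fin n) := Fin.pos_iff_nonempty.1 hn
  have hn' : (0 : ℝ) < n := by exact_mod_cast hn
  have hv0 : v ≠ 0 := by
    rw [← NNReal.coe_ne_zero, hv]
    positivity
  have hvn0 : vn ≠ 0 := by
    rw [← NNReal.coe_ne_zero, hvn]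
    positivity
  have hvn_eq : v / n = vn := by
    ext
    simp [hv, hvn]
  have hscale : |xbar - θ₀| / √(vn : ℝ) = √n * |xbar - θ₀| / σ := by
    rw [hvn, Real.sqrt_div (sq_nonneg σ), Real.sqrt_sq hσ.le]
    field_simp
  refine ⟨?_, ?_, ?_⟩
  · congr 1
    ext θ
    simp only [hL, hxbar, Set.mem_ofPred_eq, prod_gaussianPDFReal_le_iff hv0]
    simpa using sum_sub_sq_le_iff_abs_sub_mean_le x₀ θ₀ θ
  · rw [gaussianReal_abs_sub_le hvn0 (abs_nonneg _), hscale]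
  · have hmean := map_mean_pi_gaussianReal (ι := Fin n) θ₀ v
    rw [Fintype.card_fin, hvn_eq] at hmean
    rw [hmean, gaussianReal_abs_sub_lt hvn0, gaussianReal_abs_sub_le hvn0 (abs_nonneg _), hscale]
end
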